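/- arXiv:2206.01511 — 2 statements merged into one kernel-verified Lean document; each statement's English description precedes it below -/
import Mathlib

section
/- If G is a finite 2-connected outerplanar graph with Δ(G) ≥ 4 and girth g(G) ≥ 4, then χ_{vi,1}(G) ≤ Δ(G) + 3. -/
open SimpleGraph

variable {V : Type*}

/-- `(v, e)` is an incidence of `G`: `e` is an edge of `G` and `v ∈ e`. -/
def SimpleGraph.IsIncidence (G : SimpleGraph V) (v : V) (e : Sym2 V) : Prop :=
  e ∈ G.edgeSet ∧ v ∈ e

/-- A vi-simultaneous proper `k`-coloring of `G`, given by a coloring `cV` of the vertices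
and a coloring `cI` of the incidences (the value of `cI v e` matters only when `(v, e)` is
an incidence of `G`). -/
structure SimpleGraph.IsViColoring (G : SimpleGraph V) (k : ℕ)
    (cV : V → Fin k) (cI : V → Sym2 V → Fin k) : Prop where
  /-- adjacent vertices receive distinct colors -/
  adj_ne : ∀ ⦃u v⦄, G.Adj u v → cV u ≠ cV v
  /-- a vertex `u` and an incidence `(w, f)` with `u ∈ f` receive distinct colors -/
  vertex_inc_ne : ∀ ⦃u w f⦄, G.IsIncidence w f → u ∈ f → cV u ≠ cI w f
  /-- two distinct incidences `(v, e)` and `(w, f)` receive distinct colors whenever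
  `v = w`, or `e = f`, or the edge `{v, w}` equals `e` or `f` -/
  inc_ne : ∀ ⦃v e w f⦄, G.IsIncidence v e → G.IsIncidence w f → (v, e) ≠ (w, f) →
    (v = w ∨ e = f ∨ s(v, w) = e ∨ s(v, w) = f) → cI v e ≠ cI w f

/-- The set of colors appearing on the second incidences
`I_2(u) = {(v, {u, v}) : v adjacent to u}` of a vertex `u`. -/
def SimpleGraph.secondIncColors (G : SimpleGraph V) {k : ℕ}
    (cI : V → Sym2 V → Fin k) (u : V) : Set (Fin k) :=
  {a | ∃ v, G.Adj u v ∧ cI v s(u, v) = a}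

/-- The vi-simultaneous chromatic number `χ_vi(G)`. -/
noncomputable def SimpleGraph.chiVi (G : SimpleGraph V) : ℕ :=
  sInf {k | ∃ cV cI, G.IsViColoring k cV cI}

/-- `χ_{vi,s}(G)`: the least `k` admitting a vi-simultaneous `(k, s)`-coloring, i.e. a
vi-simultaneous proper `k`-coloring using at most `s` colors on `I_2(v)` for each vertex `v`. -/
noncomputable def SimpleGraph.chiViS (G : SimpleGraph V) (s : ℕ) : ℕ :=
  sInf {k | ∃ cV cI, G.IsViColoring k cV cI ∧
    ∀ u, (G.secondIncColors cI u).ncard ≤ s}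

/-- `G` is outerplanar: there is a linear ordering of the vertices such that no two edges
`{a, b}` and `{c, d}` satisfy `a < c < b < d`. -/
def SimpleGraph.Outerplanar (G : SimpleGraph V) : Prop :=
  ∃ r : LinearOrder V, ∀ a b c d : V, G.Adj a b → G.Adj c d →
    ¬(r.lt a c ∧ r.lt c b ∧ r.lt b d)

/-- The maximum degree `Δ(G)` of a finite graph. -/
noncomputable def SimpleGraph.maxDeg (G : SimpleGraph V) [Fintype V] : ℕ :=
  Finset.univ.sup fun v => (G.neighborSet v).ncard

/-- `G` is 2-connected: it has at least 3 vertices, is connected, and deleting any single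
vertex leaves it connected. -/
def SimpleGraph.TwoConnected (G : SimpleGraph V) [Fintype V] : Prop :=
  3 ≤ Fintype.card V ∧ G.Connected ∧
    ∀ v : V, (((⊤ : G.Subgraph).deleteVerts {v}).coe).Connected

namespace SimpleGraph

/-- `f` colors the square of `G.induce S` properly, `c` colors `G.induce S` properly, and `c u`
avoids the values of `f` on the closed neighborhood of `u`. Taking `f u` to be the common color of
the second incidences of `u`, this encodes a vi-simultaneous `(k, 1)`-coloring of `G.induce S`. -/
structure IsSquareColoringOn {K : Type*} (G : SimpleGraph V) (S : Finset V) (f c : V → K) :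
    Prop where
  c_ne_c : ∀ ⦃u⦄, u ∈ S → ∀ ⦃v⦄, v ∈ S → G.Adj u v → c u ≠ c v
  c_ne_f : ∀ ⦃u⦄, u ∈ S → ∀ ⦃v⦄, v ∈ S → G.Adj u v → c u ≠ f v
  c_ne_f_self : ∀ ⦃u⦄, u ∈ S → c u ≠ f u
  f_ne_f : ∀ ⦃u⦄, u ∈ S → ∀ ⦃v⦄, v ∈ S → G.Adj u v → f u ≠ f v
  f_ne_f_of_common : ∀ ⦃w⦄, w ∈ S → ∀ ⦃u⦄, u ∈ S → ∀ ⦃v⦄, v ∈ S → G.Adj w u → G.Adj w v →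
    u ≠ v → f u ≠ f v

namespace IsSquareColoringOn

variable {K : Type*} {G : SimpleGraph V} {S : Finset V} {f c : V → K}

theorem insert_update [DecidableEq V] (h : G.IsSquareColoringOn S f c) {x : V} (hx : x ∉ S)
    {a b : K} (hab : b ≠ a)
    (hN : ∀ y ∈ S, G.Adj x y → a ≠ f y ∧ a ≠ c y ∧ b ≠ f y ∧ b ≠ c y)
    (hN2 : ∀ y ∈ S, G.Adj x y → ∀ z ∈ S, G.Adj y z → a ≠ f z)
    (hf : ∀ y ∈ S, G.Adj x y → ∀ z ∈ S, G.Adj x z → y ≠ z → f y ≠ f z) :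
    G.IsSquareColoringOn (insert x S) (Function.update f x a) (Function.update c x b) := by
  have hfS : ∀ y ∈ S, Function.update f x a y = f y := fun y hy =>
    Function.update_of_ne (fun e : y = x => hx (e ▸ hy)) _ _
  have hcS : ∀ y ∈ S, Function.update c x b y = c y := fun y hy =>
    Function.update_of_ne (fun e : y = x => hx (e ▸ hy)) _ _
  have hfx : Function.update f x a x = a := Function.update_self ..
  have hcx : Function.update c x b x = b := Function.update_self ..
  obtain ⟨h1, h2, h3, h4, h5⟩ := h
  constructor <;> intro u hu
  · intro v hv huv
    rcases Finset.mem_insert.1 hu with rfl | hu <;> rcases Finset.mem_insert.1 hv with rfl | hv <;>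
      grind [G.adj_comm, G.irrefl]
  · intro v hv huv
    rcases Finset.mem_insert.1 hu with rfl | hu <;> rcases Finset.mem_insert.1 hv with rfl | hv <;>
      grind [G.adj_comm, G.irrefl]
  · rcases Finset.mem_insert.1 hu with rfl | hu <;> grind
  · intro v hv huv
    rcases Finset.mem_insert.1 hu with rfl | hu <;> rcases Finset.mem_insert.1 hv with rfl | hv <;>
      grind [G.adj_comm, G.irrefl]
  · intro v hv w hw huv huw hvw
    rcases Finset.mem_insert.1 hu with rfl | hu <;> rcases Finset.mem_insert.1 hv with rfl | hv <;>
      rcases Finset.mem_insert.1 hw with rfl | hw <;> grind [G.adj_comm, G.irrefl]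

end IsSquareColoringOn

theorem exists_notMem_of_card_lt {k : ℕ} (F : Finset (Fin k)) (h : F.card < k) : ∃ a, a ∉ F := by
  by_contra! hF
  have := Finset.card_le_card (fun a _ => hF a : Finset.univ ⊆ F)
  simp at this
  omega

section Extension

variable [Fintype V] [DecidableEq V] {G : SimpleGraph V} [DecidableRel G.Adj] {D : ℕ}
  {S : Finset V} {f c : V → Fin (D + 3)}

/-- The colors that a new neighbor `x` of `u` cannot use for `f x`. -/
def squareForbidden (G : SimpleGraph V) [DecidableRel G.Adj] (S : Finset V)
    (f c : V → Fin (D + 3)) (u : V) : Finset (Fin (D + 3)) :=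
  insert (c u) (insert (f u) ((S.filter (G.Adj u)).image f))

theorem card_squareForbidden_le (hD : ∀ u, (Finset.univ.filter (G.Adj u)).card ≤ D)
    {x u : V} (hx : x ∉ S) (hxu : G.Adj x u) : (squareForbidden G S f c u).card ≤ D + 1 := by
  have h1 : (insert x (S.filter (G.Adj u))).card ≤ (Finset.univ.filter (G.Adj u)).card := by
    apply Finset.card_le_card
    intro y hy
    rcases Finset.mem_insert.1 hy with rfl | hy
    · simp [hxu.symm]
    · simp [(Finset.mem_filter.1 hy).2]
  rw [Finset.card_insert_of_notMem (by simp [hx])] at h1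
  have h2 := (Finset.card_image_le (s := S.filter (G.Adj u)) (f := f))
  have h3 := Finset.card_insert_le (f u) ((S.filter (G.Adj u)).image f)
  have h4 := Finset.card_insert_le (c u) (insert (f u) ((S.filter (G.Adj u)).image f))
  have := hD u
  unfold squareForbidden
  omega

/-- A coloring extends to a vertex with at most one neighbor, with one extra color forbidden
for `f`, and any prescribed admissible color for `c`. -/
theorem IsSquareColoringOn.exists_insert_pendant
    (hD : ∀ u, (Finset.univ.filter (G.Adj u)).card ≤ D)
    (h : G.IsSquareColoringOn S f c) {x u : V} (hx : x ∉ S) (hxu : G.Adj x u)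
    (hN : ∀ y ∈ S, G.Adj x y → y = u) (e : Fin (D + 3)) :
    ∃ a, a ∉ squareForbidden G S f c u ∧ a ≠ e ∧
      ∀ b, b ≠ a → b ≠ f u → b ≠ c u →
        G.IsSquareColoringOn (insert x S) (Function.update f x a) (Function.update c x b) := by
  obtain ⟨a, ha⟩ := exists_notMem_of_card_lt (insert e (squareForbidden G S f c u)) (by
    have := Finset.card_insert_le e (squareForbidden G S f c u)
    have := card_squareForbidden_le (f := f) (c := c) hD hx hxu
    omega)
  have ha' : a ∉ squareForbidden G S f c u := fun h => ha (Finset.mem_insert_of_mem h)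
  refine ⟨a, ha', fun h => ha (by simp [h]), fun b hba hbf hbc => ?_⟩
  simp only [squareForbidden, Finset.mem_insert, Finset.mem_image, Finset.mem_filter, not_or,
    not_exists, not_and] at ha'
  apply h.insert_update hx hba
  · grind
  · grind
  · grind

end Extension

/-- A triangle-free graph on a linear order without crossing edges contains a vertex of degree at
most one, two adjacent vertices of degree two on a 4-cycle, or a path formed by three vertices of
degree two. -/
theorem exists_reducible [LinearOrder V] (G : SimpleGraph V)
    (hG : ∀ a b c d : V, G.Adj a b → G.Adj c d → ¬(a < c ∧ c < b ∧ b < d))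
    (htri : ∀ a b c, G.Adj a b → G.Adj b c → ¬ G.Adj a c) (S : Finset V) (hS : S.Nonempty) :
    (∃ x ∈ S, ∀ y ∈ S, ∀ z ∈ S, G.Adj x y → G.Adj x z → y = z) ∨
    (∃ u ∈ S, ∃ x ∈ S, ∃ y ∈ S, ∃ v ∈ S, u < x ∧ x < y ∧ y < v ∧ G.Adj x u ∧ G.Adj x y ∧
      G.Adj y v ∧ G.Adj u v ∧ (∀ z ∈ S, G.Adj x z → z = u ∨ z = y) ∧
      (∀ z ∈ S, G.Adj y z → z = x ∨ z = v)) ∨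
    (∃ u ∈ S, ∃ x ∈ S, ∃ y ∈ S, ∃ z ∈ S, ∃ v ∈ S, u < x ∧ x < y ∧ y < z ∧ z < v ∧
      G.Adj x u ∧ G.Adj x y ∧ G.Adj y z ∧ G.Adj z v ∧
      (∀ t ∈ S, G.Adj x t → t = u ∨ t = y) ∧ (∀ t ∈ S, G.Adj y t → t = x ∨ t = z) ∧
      (∀ t ∈ S, G.Adj z t → t = y ∨ t = v)) := by
  refine or_iff_not_imp_left.2 fun hdeg => ?_
  push Not at hdeg
  classical
  let P : Finset (V × V) := (S ×ˢ S).filter fun p =>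
    G.Adj p.1 p.2 ∧ p.1 < p.2 ∧ ∃ x ∈ S, p.1 < x ∧ x < p.2
  have hP : ∀ p : V × V, p ∈ P ↔ (p.1 ∈ S ∧ p.2 ∈ S) ∧ G.Adj p.1 p.2 ∧ p.1 < p.2 ∧
      ∃ x ∈ S, p.1 < x ∧ x < p.2 := by
    intro p
    simp [P]
  have hPne : P.Nonempty := by
    obtain ⟨m, hm, hle⟩ := S.exists_min_image id hS
    simp only [id] at hle
    obtain ⟨y, hy, z, hz, hmy, hmz, hyz⟩ := hdeg m hm
    have h1 := lt_of_le_of_ne (hle y hy) hmy.ne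
    have h2 := lt_of_le_of_ne (hle z hz) hmz.ne
    rcases lt_or_gt_of_ne hyz with h | h
    · exact ⟨(m, z), (hP _).2 ⟨⟨hm, hz⟩, hmz, h2, y, hy, h1, h⟩⟩
    · exact ⟨(m, y), (hP _).2 ⟨⟨hm, hy⟩, hmy, h1, z, hz, h2, h⟩⟩
  obtain ⟨⟨a, b⟩, hab, hmin⟩ := P.exists_min_image
    (fun p => (S.filter fun x => p.1 < x ∧ x < p.2).card) hPne
  obtain ⟨⟨ha, hb⟩, habE, hab, x₀, hx₀, hax₀, hx₀b⟩ := (hP _).1 hab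
  simp only at ha hb habE hab hax₀ hx₀b hmin
  have hshort : ∀ p ∈ S, ∀ q ∈ S, G.Adj p q → p < q → a ≤ p → q ≤ b → (a < p ∨ q < b) →
      ∀ y ∈ S, p < y → ¬ y < q := by
    intro p hp q hq hpq hlt hap hqb hne y hy hpy hyq
    refine (hmin (p, q) ((hP _).2 ⟨⟨hp, hq⟩, hpq, hlt, y, hy, hpy, hyq⟩)).not_gt ?_
    apply Finset.card_lt_card
    rw [Finset.ssubset_iff_of_subset]
    · rcases hne with h | h
      · exact ⟨p, by simp [hp, h, hlt.trans_le hqb], by simp⟩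
      · exact ⟨q, by simp [hq, h, hap.trans_lt hlt], by simp⟩
    · intro t ht
      simp only [Finset.mem_filter] at ht ⊢
      exact ⟨ht.1, hap.trans_lt ht.2.1, ht.2.2.trans_le hqb⟩
  have hnear : ∀ x ∈ S, a < x → x < b → ∃ p ∈ S, ∃ q ∈ S, a ≤ p ∧ p < x ∧ x < q ∧ q ≤ b ∧
      G.Adj x p ∧ G.Adj x q ∧ (∀ y ∈ S, G.Adj x y → y = p ∨ y = q) ∧
      (∀ y ∈ S, p < y → ¬ y < x) ∧ (∀ y ∈ S, x < y → ¬ y < q) := by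
    intro x hx hax hxb
    have hin : ∀ y ∈ S, G.Adj x y → a ≤ y ∧ y ≤ b := by
      intro y hy hxy
      refine ⟨le_of_not_gt fun h => ?_, le_of_not_gt fun h => ?_⟩
      · exact hG y x a b hxy.symm habE ⟨h, hax, hxb⟩
      · exact hG a b x y habE hxy ⟨hax, hxb, h⟩
    have hup : ∀ y ∈ S, G.Adj x y → x < y → ∀ t ∈ S, x < t → ¬ t < y := fun y hy hxy hlt =>
      hshort x hx y hy hxy hlt hax.le (hin y hy hxy).2 (Or.inl hax)
    have hdown : ∀ y ∈ S, G.Adj x y → y < x → ∀ t ∈ S, y < t → ¬ t < x := fun y hy hxy hlt =>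
      hshort y hy x hx hxy.symm hlt (hin y hy hxy).1 hxb.le (Or.inr hxb)
    have hupu : ∀ y ∈ S, ∀ z ∈ S, G.Adj x y → G.Adj x z → x < y → x < z → y = z := by
      intro y hy z hz h1 h2 h3 h4
      exact le_antisymm (le_of_not_gt (hup y hy h1 h3 z hz h4))
        (le_of_not_gt (hup z hz h2 h4 y hy h3))
    have hdownu : ∀ y ∈ S, ∀ z ∈ S, G.Adj x y → G.Adj x z → y < x → z < x → y = z := by
      intro y hy z hz h1 h2 h3 h4
      exact le_antisymm (le_of_not_gt fun h => hdown z hz h2 h4 y hy h h3)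
        (le_of_not_gt fun h => hdown y hy h1 h3 z hz h h4)
    obtain ⟨y, hy, z, hz, hxy, hxz, hyz⟩ := hdeg x hx
    have key : ∀ p ∈ S, ∀ q ∈ S, G.Adj x p → G.Adj x q → p < x → x < q →
        ∃ p ∈ S, ∃ q ∈ S, a ≤ p ∧ p < x ∧ x < q ∧ q ≤ b ∧
        G.Adj x p ∧ G.Adj x q ∧ (∀ y ∈ S, G.Adj x y → y = p ∨ y = q) ∧
        (∀ y ∈ S, p < y → ¬ y < x) ∧ (∀ y ∈ S, x < y → ¬ y < q) := by
      intro p hp q hq hxp hxq hlt hgt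
      refine ⟨p, hp, q, hq, (hin p hp hxp).1, hlt, hgt, (hin q hq hxq).2, hxp, hxq, ?_,
        hdown p hp hxp hlt, hup q hq hxq hgt⟩
      intro t ht hxt
      rcases lt_or_gt_of_ne hxt.ne with h | h
      · exact Or.inr (hupu t ht q hq hxt hxq h hgt)
      · exact Or.inl (hdownu t ht p hp hxt hxp h hlt)
    rcases lt_or_gt_of_ne hxy.ne with h1 | h1 <;> rcases lt_or_gt_of_ne hxz.ne with h2 | h2
    · exact (hyz (hupu y hy z hz hxy hxz h1 h2)).elim
    · exact key z hz y hy hxz hxy h2 h1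
    · exact key y hy z hz hxy hxz h1 h2
    · exact (hyz (hdownu y hy z hz hxy hxz h1 h2)).elim
  have hTne : (S.filter fun x => a < x ∧ x < b).Nonempty := ⟨x₀, by simp [hx₀, hax₀, hx₀b]⟩
  obtain ⟨x, hxT, hxmin⟩ := (S.filter fun x => a < x ∧ x < b).exists_min_image id hTne
  simp only [Finset.mem_filter, id] at hxT hxmin
  obtain ⟨hx, hax, hxb⟩ := hxT
  obtain ⟨p, hp, y, hy, hap, hpx, hxy, hyb, hxpE, hxyE, hxN, hxp, hxup⟩ := hnear x hx hax hxb
  obtain rfl : a = p := by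
    by_contra h
    exact (hxmin p ⟨hp, lt_of_le_of_ne hap h, hpx.trans hxb⟩).not_gt hpx
  rcases hyb.eq_or_lt with rfl | hyb
  · exact (htri a x y hxpE.symm hxyE habE).elim
  obtain ⟨p, hp, z, hz, hap', hpy, hyz, hzb, hypE, hyzE, hyN, hydown, hyup⟩ :=
    hnear y hy (hax.trans hxy) hyb
  obtain rfl : x = p := le_antisymm (le_of_not_gt fun h => hydown x hx h hxy)
    (le_of_not_gt fun h => hxup p hp h hpy)
  rcases hzb.eq_or_lt with rfl | hzb
  · exact Or.inl ⟨a, ha, x, hx, y, hy, z, hz, hax, hxy, hyz, hxpE, hxyE, hyzE, habE, hxN, hyN⟩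
  obtain ⟨p, hp, v, hv, hap'', hpz, hzv, -, hzpE, hzvE, hzN, hzdown, -⟩ :=
    hnear z hz (hax.trans (hxy.trans hyz)) hzb
  obtain rfl : y = p := le_antisymm (le_of_not_gt fun h => hzdown y hy h hyz)
    (le_of_not_gt fun h => hyup p hp h hpz)
  exact Or.inr ⟨a, ha, x, hx, y, hy, z, hz, v, hv, hax, hxy, hyz, hzv, hxpE, hxyE, hyzE, hzvE,
    hxN, hyN, hzN⟩

theorem exists_isSquareColoringOn [Fintype V] [LinearOrder V] (G : SimpleGraph V)
    [DecidableRel G.Adj] {D : ℕ} (hD4 : 4 ≤ D)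
    (hD : ∀ u, (Finset.univ.filter (G.Adj u)).card ≤ D)
    (hG : ∀ a b c d : V, G.Adj a b → G.Adj c d → ¬(a < c ∧ c < b ∧ b < d))
    (htri : ∀ a b c, G.Adj a b → G.Adj b c → ¬ G.Adj a c) (S : Finset V) :
    ∃ f c : V → Fin (D + 3), G.IsSquareColoringOn S f c := by
  induction S using Finset.strongInduction with
  | H S ih =>
  rcases S.eq_empty_or_nonempty with rfl | hS
  · exact ⟨fun _ => 0, fun _ => 0, by constructor <;> simp⟩
  have hred := G.exists_reducible hG htri S hS
  clear hG htri
  rcases hred with ⟨x, hx, hN⟩ | ⟨u, hu, x, hx, y, hy, v, hv, hux, hxy,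
      hyv, hxuE, hxyE, hyvE, huvE, hxN, hyN⟩ | ⟨u, hu, x, hx, y, hy, z, hz, v, hv, hux, hxy, hyz,
      hzv, hxuE, hxyE, hyzE, hzvE, hxN, hyN, hzN⟩
  · obtain ⟨f, c, h⟩ := ih (S.erase x) (Finset.erase_ssubset hx)
    have hxS : x ∉ S.erase x := by simp
    rw [← Finset.insert_erase hx]
    by_cases hex : ∃ u ∈ S.erase x, G.Adj x u
    · obtain ⟨u, hu, hxu⟩ := hex
      obtain ⟨a, -, -, hext⟩ := h.exists_insert_pendant hD hxS hxu
        (fun y hy hxy => hN y (Finset.mem_of_mem_erase hy) u (Finset.mem_of_mem_erase hu) hxy hxu) 0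
      obtain ⟨b, hb⟩ := exists_notMem_of_card_lt ({a, f u, c u} : Finset (Fin (D + 3)))
        (Finset.card_le_three.trans_lt (by omega))
      simp only [Finset.mem_insert, Finset.mem_singleton, not_or] at hb
      exact ⟨_, _, hext b hb.1 hb.2.1 hb.2.2⟩
    · push Not at hex
      refine ⟨_, _, h.insert_update hxS (a := 0) (b := 1) ?_ ?_ ?_ ?_⟩
      · simp
      all_goals grind
  · set T := (S.erase y).erase x with hT
    obtain ⟨f, c, h⟩ := ih T (Finset.ssubset_iff_subset_ne.2
      ⟨by clear ih; grind, by clear ih; grind⟩)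
    clear ih
    have hTS : insert y (insert x T) = S := by grind
    have hxT : x ∉ T := by grind
    have hyT : y ∉ insert x T := by grind
    have huT : u ∈ T := by grind
    have hvT : v ∈ T := by grind
    obtain ⟨a, ha, -, hext⟩ := h.exists_insert_pendant hD hxT hxuE (by grind) 0
    simp only [squareForbidden, Finset.mem_insert, Finset.mem_image, Finset.mem_filter, not_or,
      not_exists, not_and] at ha
    have h' := hext (f v) (ha.2.2 v ⟨hvT, huvE⟩) (h.f_ne_f hvT huT huvE.symm)
      (h.c_ne_f huT hvT huvE).symm
    have hfT : ∀ t ∈ T, Function.update f x a t = f t := by grind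
    have hcT : ∀ t ∈ T, Function.update c x (f v) t = c t := by grind
    have hfx : Function.update f x a x = a := by grind
    have hcx : Function.update c x (f v) x = f v := by grind
    obtain ⟨a', ha'⟩ := exists_notMem_of_card_lt (insert a (squareForbidden G T f c v)) (by
      have := Finset.card_insert_le a (squareForbidden G T f c v)
      have := card_squareForbidden_le (S := T) (f := f) (c := c) hD (by grind) hyvE
      omega)
    simp only [squareForbidden, Finset.mem_insert, Finset.mem_image, Finset.mem_filter, not_or,
      not_exists, not_and] at ha'
    obtain ⟨b', hb'⟩ := exists_notMem_of_card_lt ({a', f v, a, c v} : Finset (Fin (D + 3)))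
      (Finset.card_le_four.trans_lt (by omega))
    simp only [Finset.mem_insert, Finset.mem_singleton, not_or] at hb'
    rw [← hTS]
    have hyN' : ∀ t ∈ insert x T, G.Adj y t → t = x ∨ t = v := by grind
    have hxN' : ∀ t ∈ insert x T, G.Adj x t → t = u := by grind
    have hvN' : ∀ t ∈ insert x T, G.Adj v t → t ∈ T := by grind [G.adj_comm]
    refine ⟨_, _, h'.insert_update hyT (a := a') (b := b') hb'.1 ?_ ?_ ?_⟩
    · intro t ht hyt
      rcases hyN' t ht hyt with rfl | rfl
      · grind
      · grind
    · intro t ht hyt s hs hts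
      rcases hyN' t ht hyt with rfl | rfl
      · grind [G.adj_comm]
      · grind
    · grind [G.adj_comm]
  · set T := ((S.erase z).erase y).erase x with hT
    obtain ⟨f, c, h⟩ := ih T (Finset.ssubset_iff_subset_ne.2
      ⟨by clear ih; grind, by clear ih; grind⟩)
    clear ih
    have hTS : insert y (insert z (insert x T)) = S := by grind
    have hxT : x ∉ T := by grind
    have hzT : z ∉ insert x T := by grind
    have hyT : y ∉ insert z (insert x T) := by grind
    have huT : u ∈ T := by grind
    have hvT : v ∈ T := by grind
    obtain ⟨a, -, -, hext⟩ := h.exists_insert_pendant hD hxT hxuE (by grind) 0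
    obtain ⟨b, hb⟩ := exists_notMem_of_card_lt ({a, f u, c u} : Finset (Fin (D + 3)))
      (Finset.card_le_three.trans_lt (by omega))
    simp only [Finset.mem_insert, Finset.mem_singleton, not_or] at hb
    have h₁ := hext b hb.1 hb.2.1 hb.2.2
    generalize hf₁ : Function.update f x a = f₁ at h₁
    generalize hc₁ : Function.update c x b = c₁ at h₁
    obtain ⟨a', -, ha', hext'⟩ := h₁.exists_insert_pendant hD hzT hzvE
      (by grind [G.adj_comm]) (f₁ x)
    obtain ⟨b', hb'⟩ := exists_notMem_of_card_lt ({a', f₁ v, c₁ v} : Finset (Fin (D + 3)))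
      (Finset.card_le_three.trans_lt (by omega))
    simp only [Finset.mem_insert, Finset.mem_singleton, not_or] at hb'
    have h₂ := hext' b' hb'.1 hb'.2.1 hb'.2.2
    have hxz : Function.update f₁ z a' x ≠ Function.update f₁ z a' z := by grind
    generalize Function.update f₁ z a' = f₂ at h₂ hxz
    generalize Function.update c₁ z b' = c₂ at h₂
    obtain ⟨a₂, ha₂⟩ := exists_notMem_of_card_lt
      ({f₂ u, f₂ v, f₂ x, f₂ z, c₂ x, c₂ z} : Finset (Fin (D + 3)))
      (Finset.card_le_six.trans_lt (by omega))
    obtain ⟨b₂, hb₂⟩ := exists_notMem_of_card_lt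
      ({a₂, f₂ x, f₂ z, c₂ x, c₂ z} : Finset (Fin (D + 3)))
      (Finset.card_le_five.trans_lt (by omega))
    simp only [Finset.mem_insert, Finset.mem_singleton, not_or] at ha₂ hb₂
    have hyN' : ∀ t ∈ insert z (insert x T), G.Adj y t → t = x ∨ t = z := by grind
    have hxN' : ∀ t ∈ insert z (insert x T), G.Adj x t → t = u := by grind
    have hzN' : ∀ t ∈ insert z (insert x T), G.Adj z t → t = v := by grind
    rw [← hTS]
    refine ⟨_, _, h₂.insert_update hyT (a := a₂) (b := b₂) hb₂.1 ?_ ?_ ?_⟩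
    · grind
    · intro t ht hyt s hs hts
      rcases hyN' t ht hyt with rfl | rfl
      · grind
      · grind
    · grind

/-- The color `f u` is given to all second incidences `(v, {u, v})` of `u`. -/
noncomputable def secondIncColoring {K : Type*} (f : V → K) (v : V) (e : Sym2 V) : K :=
  open Classical in if h : v ∈ e then f (Sym2.Mem.other h) else f v

theorem secondIncColoring_mk {K : Type*} (f : V → K) (u v : V) :
    secondIncColoring f v s(v, u) = f u := by
  have h : v ∈ s(v, u) := Sym2.mem_mk_left v u
  rw [secondIncColoring, dif_pos h, Sym2.congr_right.1 (Sym2.other_spec h)]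

theorem IsIncidence.exists_eq {G : SimpleGraph V} {v : V} {e : Sym2 V} (h : G.IsIncidence v e) :
    ∃ u, G.Adj v u ∧ e = s(v, u) := by
  obtain ⟨he, u, rfl⟩ := h
  exact ⟨u, he, rfl⟩

theorem IsSquareColoringOn.isViColoring [Fintype V] {G : SimpleGraph V} {k : ℕ}
    {f c : V → Fin k} (h : G.IsSquareColoringOn Finset.univ f c) :
    G.IsViColoring k c (secondIncColoring f) := by
  refine ⟨fun u v huv => h.c_ne_c (Finset.mem_univ _) (Finset.mem_univ _) huv, ?_, ?_⟩
  · intro u w e hw hu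
    obtain ⟨x, hwx, rfl⟩ := hw.exists_eq
    rw [secondIncColoring_mk]
    rcases Sym2.mem_iff.1 hu with rfl | rfl
    · exact h.c_ne_f (Finset.mem_univ _) (Finset.mem_univ _) hwx
    · exact h.c_ne_f_self (Finset.mem_univ _)
  · intro v e w e' hv hw hne hor
    obtain ⟨x, hvx, rfl⟩ := hv.exists_eq
    obtain ⟨y, hwy, rfl⟩ := hw.exists_eq
    rw [secondIncColoring_mk, secondIncColoring_mk]
    have hff : ∀ a b, G.Adj a b → f a ≠ f b := fun a b =>
      h.f_ne_f (Finset.mem_univ _) (Finset.mem_univ _)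
    have hcom : ∀ d a b, G.Adj d a → G.Adj d b → a ≠ b → f a ≠ f b := fun d a b =>
      h.f_ne_f_of_common (Finset.mem_univ _) (Finset.mem_univ _) (Finset.mem_univ _)
    rcases hor with rfl | hor | hor | hor
    · exact hcom v x y hvx hwy (by rintro rfl; exact hne rfl)
    · rcases Sym2.eq_iff.1 hor with ⟨rfl, rfl⟩ | ⟨rfl, rfl⟩
      · exact (hne rfl).elim
      · exact hff _ _ hvx.symm
    · obtain rfl := Sym2.congr_right.1 hor
      exact hff _ _ hwy
    · rw [Sym2.eq_swap] at hor
      obtain rfl := Sym2.congr_right.1 hor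
      exact (hff _ _ hvx).symm

theorem secondIncColors_secondIncColoring_ncard_le (G : SimpleGraph V) {k : ℕ} (f : V → Fin k)
    (u : V) : (G.secondIncColors (secondIncColoring f) u).ncard ≤ 1 := by
  have hsub : G.secondIncColors (secondIncColoring f) u ⊆ {f u} := by
    rintro _ ⟨v, -, rfl⟩
    rw [Sym2.eq_swap, secondIncColoring_mk]
    rfl
  exact (Set.ncard_le_ncard hsub).trans (Set.ncard_singleton _).le

theorem not_adj_of_four_le_egirth {G : SimpleGraph V} (hg : 4 ≤ G.egirth) (a b c : V)
    (hab : G.Adj a b) (hbc : G.Adj b c) : ¬ G.Adj a c := by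
  intro hac
  have hcyc : (Walk.cons hab (Walk.cons hbc (Walk.cons hac.symm Walk.nil))).IsCycle := by
    rw [Walk.isCycle_def]
    simp [Walk.isTrail_def, hab.ne, hbc.ne, hac.ne, hab.ne', hac.ne']
  have := le_egirth.1 hg a _ hcyc
  simp only [Walk.length_cons, Walk.length_nil] at this
  exact absurd (by exact_mod_cast this : 4 ≤ 0 + 1 + 1 + 1) (by omega)

end SimpleGraph

/-- If `G` is a finite 2-connected outerplanar graph with `Δ(G) ≥ 4` and girth `g(G) ≥ 4`,
then `χ_{vi,1}(G) ≤ Δ(G) + 3`. -/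
theorem chiViS_one_le_of_twoConnected [Fintype V] (G : SimpleGraph V) (hG : G.Outerplanar)
    (h2 : G.TwoConnected) (hΔ : 4 ≤ G.maxDeg) (hg : 4 ≤ G.egirth) :
    G.chiViS 1 ≤ G.maxDeg + 3 := by
  classical
  obtain ⟨r, hr⟩ := hG
  have hD : ∀ u, (Finset.univ.filter (G.Adj u)).card ≤ G.maxDeg := by
    intro u
    refine le_trans (le_of_eq ?_)
      (Finset.le_sup (f := fun v => (G.neighborSet v).ncard) (Finset.mem_univ u))
    rw [← Set.ncard_coe_finset]
    congr 1
    ext v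
    simp
  obtain ⟨f, c, h⟩ := @exists_isSquareColoringOn V _ r G _ _ hΔ hD hr
    (not_adj_of_four_le_egirth hg) Finset.univ
  exact Nat.sInf_le ⟨c, secondIncColoring f, h.isViColoring,
    G.secondIncColors_secondIncColoring_ncard_le f⟩
end

section
/- For every natural number n ≥ 3, the cycle C_n satisfies: χ_{vi,1}(C_n) = 6 if n = 3; χ_{vi,1}(C_n) = 4 if n ≡ 0 (mod 4); and χ_{vi,1}(C_n) = 5 otherwise. -/
open SimpleGraph

variable {V : Type*}

/-- A vertex coloring `c` together with a coloring `a` of the vertices that encodes a coloring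
of the incidences: the incidence `(v, {u, v})` has color `a u`. -/
structure SimpleGraph.IsSecondColoring {α : Type*} (G : SimpleGraph V) (c a : V → α) : Prop where
  self_ne : ∀ u, c u ≠ a u
  adj_ne : ∀ ⦃u v⦄, G.Adj u v → c u ≠ c v
  vertex_ne : ∀ ⦃u v⦄, G.Adj u v → c u ≠ a v
  second_ne : ∀ ⦃u v⦄, G.Adj u v → a u ≠ a v
  square_ne : ∀ ⦃u v w⦄, G.Adj v u → G.Adj v w → u ≠ w → a u ≠ a w

theorem SimpleGraph.IsSecondColoring.exists_isViColoring {G : SimpleGraph V} {k : ℕ}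
    {c a : V → Fin k} (h : G.IsSecondColoring c a) :
    ∃ cV cI, G.IsViColoring k cV cI ∧ ∀ u, (G.secondIncColors cI u).ncard ≤ 1 := by
  classical
  let cI : V → Sym2 V → Fin k := fun v e => if hv : v ∈ e then a (Sym2.Mem.other hv) else c v
  have hcI : ∀ v x, cI v s(v, x) = a x := by
    intro v x
    have hv : v ∈ s(v, x) := Sym2.mem_mk_left v x
    have : Sym2.Mem.other hv = x := Sym2.congr_right.1 (Sym2.other_spec hv)
    simp only [cI, dif_pos hv, this]
  refine ⟨c, cI, ⟨h.adj_ne, ?_, ?_⟩, ?_⟩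
  · rintro u w f ⟨hf, hw⟩ hu
    obtain ⟨x, rfl⟩ := Sym2.mem_iff_exists.1 hw
    rw [hcI]
    rcases Sym2.mem_iff.1 hu with rfl | rfl
    · exact h.vertex_ne hf
    · exact h.self_ne _
  · rintro v e w f ⟨he, hv⟩ ⟨hf, hw⟩ hne hcases
    obtain ⟨x, rfl⟩ := Sym2.mem_iff_exists.1 hv
    obtain ⟨y, rfl⟩ := Sym2.mem_iff_exists.1 hw
    rw [hcI, hcI]
    rw [mem_edgeSet] at he hf
    rcases hcases with rfl | hef | hvw | hvw
    · exact h.square_ne he hf (by rintro rfl; exact hne rfl)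
    · rcases Sym2.eq_iff.1 hef with ⟨rfl, rfl⟩ | ⟨rfl, rfl⟩
      · exact absurd rfl hne
      · exact h.second_ne hf
    · obtain rfl := Sym2.congr_right.1 hvw
      exact h.second_ne hf
    · rw [Sym2.eq_swap] at hvw
      obtain rfl := Sym2.congr_right.1 hvw
      exact h.second_ne he.symm
  · intro u
    refine (Set.ncard_le_ncard (t := {a u}) ?_).trans (Set.ncard_singleton _).le
    rintro _ ⟨v, -, rfl⟩
    rw [Sym2.eq_swap, hcI]
    rfl

theorem SimpleGraph.IsViColoring.exists_isSecondColoring {G : SimpleGraph V} {k : ℕ}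
    {cV : V → Fin k} {cI : V → Sym2 V → Fin k} (h : G.IsViColoring k cV cI)
    (hs : ∀ u, (G.secondIncColors cI u).ncard ≤ 1) (hG : ∀ u, ∃ v, G.Adj u v) :
    ∃ a, G.IsSecondColoring cV a := by
  choose t ht using hG
  have ha : ∀ ⦃u v⦄, G.Adj u v → cI (t u) s(u, t u) = cI v s(u, v) := fun u v huv =>
    (Set.ncard_le_one (Set.toFinite _)).1 (hs u) _ ⟨t u, ht u, rfl⟩ _ ⟨v, huv, rfl⟩
  have inc : ∀ ⦃u v⦄, G.Adj u v → G.IsIncidence v s(u, v) := fun u v huv =>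
    ⟨huv, Sym2.mem_mk_right u v⟩
  refine ⟨fun u => cI (t u) s(u, t u), ?_, h.adj_ne, ?_, ?_, ?_⟩
  · exact fun u => h.vertex_inc_ne (inc (ht u)) (Sym2.mem_mk_left _ _)
  · intro u v huv
    simp only [ha huv.symm]
    exact h.vertex_inc_ne (inc huv.symm) (Sym2.mem_mk_right _ _)
  · intro u v huv
    simp only [ha huv, ha huv.symm]
    refine h.inc_ne (inc huv) (inc huv.symm) ?_ (Or.inr (Or.inl Sym2.eq_swap))
    intro heq
    exact huv.ne (Prod.ext_iff.1 heq).1.symm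
  · intro u v w hu hw huw
    simp only [ha hu.symm, ha hw.symm]
    refine h.inc_ne (inc hu.symm) (inc hw.symm) ?_ (Or.inl rfl)
    intro heq
    exact huw (Sym2.congr_left.1 (Prod.ext_iff.1 heq).2)

theorem cycleGraph_adj_iff_eq_add_one {n : ℕ} {u v : Fin (n + 3)} :
    (cycleGraph (n + 3)).Adj u v ↔ v = u + 1 ∨ u = v + 1 := by
  rw [cycleGraph_adj, sub_eq_iff_eq_add', sub_eq_iff_eq_add', or_comm, add_comm u, add_comm v,
    add_comm 1, add_comm 1]

theorem cycleGraph_isSecondColoring_iff {α : Type*} {n : ℕ} {c a : Fin (n + 3) → α} :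
    (cycleGraph (n + 3)).IsSecondColoring c a ↔
      ∀ u, c u ≠ a u ∧ c u ≠ c (u + 1) ∧ c u ≠ a (u + 1) ∧ c (u + 1) ≠ a u ∧
        a u ≠ a (u + 1) ∧ a u ≠ a (u + 1 + 1) := by
  have two : ∀ u : Fin (n + 3), u ≠ u + 1 + 1 := by
    intro u hu
    rw [add_assoc, left_eq_add, Fin.ext_iff] at hu
    simp [Fin.val_add, Nat.mod_eq_of_lt (show 2 < n + 3 by omega)] at hu
  constructor
  · intro h u
    have h₁ : (cycleGraph (n + 3)).Adj u (u + 1) := cycleGraph_adj_iff_eq_add_one.2 (Or.inl rfl)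
    have h₂ : (cycleGraph (n + 3)).Adj (u + 1) (u + 1 + 1) :=
      cycleGraph_adj_iff_eq_add_one.2 (Or.inl rfl)
    exact ⟨h.self_ne u, h.adj_ne h₁, h.vertex_ne h₁, h.vertex_ne h₁.symm, h.second_ne h₁,
      h.square_ne h₁.symm h₂ (two u)⟩
  · intro h
    refine ⟨fun u => (h u).1, ?_, ?_, ?_, ?_⟩
    · intro u v huv
      rcases cycleGraph_adj_iff_eq_add_one.1 huv with rfl | rfl
      exacts [(h _).2.1, (h _).2.1.symm]
    · intro u v huv
      rcases cycleGraph_adj_iff_eq_add_one.1 huv with rfl | rfl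
      exacts [(h _).2.2.1, (h _).2.2.2.1]
    · intro u v huv
      rcases cycleGraph_adj_iff_eq_add_one.1 huv with rfl | rfl
      exacts [(h _).2.2.2.2.1, (h _).2.2.2.2.1.symm]
    · intro u v w hu hw huw
      rcases cycleGraph_adj_iff_eq_add_one.1 hu with rfl | rfl <;>
        rcases cycleGraph_adj_iff_eq_add_one.1 hw with rfl | hvw
      · exact absurd rfl huw
      · rw [hvw]
        exact (h _).2.2.2.2.2.symm
      · exact (h _).2.2.2.2.2
      · exact absurd (add_right_cancel hvw) huw

theorem cycleGraph_chiViS_one_eq {n k : ℕ}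
    (hex : ∃ c a : Fin (n + 3) → Fin k, (cycleGraph (n + 3)).IsSecondColoring c a)
    (hle : ∀ (l : ℕ) (c a : Fin (n + 3) → Fin l),
      (cycleGraph (n + 3)).IsSecondColoring c a → k ≤ l) :
    (cycleGraph (n + 3)).chiViS 1 = k := by
  obtain ⟨c, a, h⟩ := hex
  refine IsLeast.csInf_eq ⟨h.exists_isViColoring, ?_⟩
  rintro l ⟨cV, cI, hc, hs⟩
  obtain ⟨b, hb⟩ := hc.exists_isSecondColoring hs
    fun u => ⟨u + 1, cycleGraph_adj_iff_eq_add_one.2 (Or.inl rfl)⟩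
  exact hle l cV b hb

theorem four_le_of_cycleGraph_isSecondColoring {n k : ℕ} {c a : Fin (n + 3) → Fin k}
    (h : (cycleGraph (n + 3)).IsSecondColoring c a) : 4 ≤ k := by
  rw [cycleGraph_isSecondColoring_iff] at h
  obtain ⟨-, -, -, h₁, h₂, h₃⟩ := h 0
  obtain ⟨h₄, -, h₅, -, h₆, -⟩ := h (0 + 1)
  simp only [ne_eq, Fin.ext_iff] at *
  by_contra! hk
  omega

open Fin.CommRing in
theorem four_dvd_of_cycleGraph_isSecondColoring {n : ℕ} {c a : Fin (n + 3) → Fin 4}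
    (h : (cycleGraph (n + 3)).IsSecondColoring c a) : (n + 3) % 4 = 0 := by
  rw [cycleGraph_isSecondColoring_iff] at h
  have three : ∀ u, a u ≠ a (u + 1 + 1 + 1) := by
    intro u
    obtain ⟨-, -, -, h₁, h₂, h₃⟩ := h u
    obtain ⟨h₄, h₅, h₆, h₇, h₈, h₉⟩ := h (u + 1)
    obtain ⟨h₁₀, -, h₁₁, -, h₁₂, -⟩ := h (u + 1 + 1)
    clear h
    generalize u + 1 + 1 + 1 = z at *
    generalize u + 1 + 1 = y at *
    generalize u + 1 = x at *
    simp only [ne_eq, Fin.ext_iff] at *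
    omega
  have four : ∀ u, a (u + 1 + 1 + 1 + 1) = a u := by
    intro u
    obtain ⟨-, -, -, -, h₁, h₂⟩ := h u
    obtain ⟨-, -, -, -, h₃, h₄⟩ := h (u + 1)
    obtain ⟨-, -, -, -, h₅, h₆⟩ := h (u + 1 + 1)
    obtain ⟨-, -, -, -, h₇, -⟩ := h (u + 1 + 1 + 1)
    have t₀ := three u
    have t₁ := three (u + 1)
    clear h three
    generalize u + 1 + 1 + 1 + 1 = w at *
    generalize u + 1 + 1 + 1 = z at *
    generalize u + 1 + 1 = y at *
    generalize u + 1 = x at *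
    simp only [ne_eq, Fin.ext_iff] at *
    omega
  have per : Function.Periodic (fun i : ℕ => a i) 4 := by
    intro i
    refine (congrArg a ?_).trans (four i)
    push_cast
    ring
  have key : a ((n + 3) % 4 : ℕ) = a 0 := by
    rw [per.map_mod_nat (n + 3), Fin.natCast_self]
  have h₀ := h 0
  have t₀ := three 0
  have hlt : (n + 3) % 4 < 4 := Nat.mod_lt _ (by norm_num)
  generalize (n + 3) % 4 = r at key hlt
  interval_cases r
  · rfl
  · exact absurd (by simpa using key.symm) h₀.2.2.2.2.1
  · refine absurd (key.symm.trans (congrArg a ?_)) h₀.2.2.2.2.2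
    push_cast
    ring
  · refine absurd (key.symm.trans (congrArg a ?_)) t₀
    push_cast
    ring

/-- Colors `C` and `A` at the `4 + L` positions of a block of length `4` followed by a block of
length `L` give a coloring of the cycle of length `4 * m + L`, if the conditions hold along all
transitions between positions that occur when the first block is repeated `m` times. -/
theorem exists_cycleGraph_isSecondColoring {α : Type*} {n m L : ℕ} (hL : 4 ≤ L)
    (hn : n + 3 = 4 * m + L) (C A : Fin (4 + L) → α)
    (H : ∀ p q r : Fin (4 + L),
      (p.val + 1 = q.val ∨ (p.val = 3 ∨ p.val = 3 + L) ∧ (q.val = 0 ∨ q.val = 4)) →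
      (q.val + 1 = r.val ∨ (q.val = 3 ∨ q.val = 3 + L) ∧ (r.val = 0 ∨ r.val = 4)) →
      C p ≠ A p ∧ C p ≠ C q ∧ C p ≠ A q ∧ C q ≠ A p ∧ A p ≠ A q ∧ A p ≠ A r) :
    ∃ c a : Fin (n + 3) → α, (cycleGraph (n + 3)).IsSecondColoring c a := by
  let pos : Fin (n + 3) → Fin (4 + L) := fun i =>
    if h : i.val < 4 * m then ⟨i.val % 4, by omega⟩ else ⟨4 + (i.val - 4 * m), by omega⟩
  have hpos : ∀ i, (pos i).val = if i.val < 4 * m then i.val % 4 else 4 + (i.val - 4 * m) := by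
    intro i
    simp only [pos]
    split_ifs <;> rfl
  have step : ∀ i, (pos i).val + 1 = (pos (i + 1)).val ∨
      ((pos i).val = 3 ∨ (pos i).val = 3 + L) ∧
        ((pos (i + 1)).val = 0 ∨ (pos (i + 1)).val = 4) := by
    intro i
    have hi := i.isLt
    rw [hpos, hpos, Fin.val_add_one]
    simp only [Fin.ext_iff, Fin.val_last]
    split_ifs <;> omega
  exact ⟨C ∘ pos, A ∘ pos, cycleGraph_isSecondColoring_iff.2 fun i =>
    H _ _ _ (step i) (step (i + 1))⟩

theorem six_le_of_cycleGraph_three_isSecondColoring {k : ℕ} {c a : Fin (0 + 3) → Fin k}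
    (h : (cycleGraph (0 + 3)).IsSecondColoring c a) : 6 ≤ k := by
  rw [cycleGraph_isSecondColoring_iff] at h
  have h₀ := h 0
  have h₁ := h 1
  have h₂ := h 2
  have e₁ : (0 : Fin (0 + 3)) + 1 = 1 := rfl
  have e₂ : (1 : Fin (0 + 3)) + 1 = 2 := rfl
  have e₃ : (2 : Fin (0 + 3)) + 1 = 0 := rfl
  simp only [e₁, e₂, e₃] at h₀ h₁ h₂
  have hcard : ({c 0, c 1, c 2, a 0, a 1, a 2} : Finset (Fin k)).card = 6 := by
    repeat rw [Finset.card_insert_of_notMem]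
    · simp
    all_goals
      simp only [Finset.mem_insert, Finset.mem_singleton]
      grind
  simpa [hcard] using Finset.card_le_univ ({c 0, c 1, c 2, a 0, a 1, a 2} : Finset (Fin k))

/-- For `n ≥ 3`, the cycle `C_n` satisfies `χ_{vi,1}(C_n) = 6` if `n = 3`,
`χ_{vi,1}(C_n) = 4` if `4 ∣ n`, and `χ_{vi,1}(C_n) = 5` otherwise. -/
theorem chiViS_one_cycleGraph (n : ℕ) (hn : 3 ≤ n) :
    (SimpleGraph.cycleGraph n).chiViS 1 =
      if n = 3 then 6 else if n % 4 = 0 then 4 else 5 := by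
  obtain ⟨n, rfl⟩ := Nat.exists_eq_add_of_le' hn
  split_ifs with h3 h4
  · obtain rfl : n = 0 := by omega
    refine cycleGraph_chiViS_one_eq ⟨![3, 4, 5], ![0, 1, 2], ?_⟩
      fun l c a h => six_le_of_cycleGraph_three_isSecondColoring h
    rw [cycleGraph_isSecondColoring_iff]
    decide
  · refine cycleGraph_chiViS_one_eq ?_ fun l c a h => four_le_of_cycleGraph_isSecondColoring h
    exact exists_cycleGraph_isSecondColoring (m := (n + 3) / 4 - 1) (L := 4) (by omega) (by omega)
      ![2, 3, 0, 1, 2, 3, 0, 1] ![0, 1, 2, 3, 0, 1, 2, 3] (by decide)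
  · refine cycleGraph_chiViS_one_eq ?_ fun l c a h => ?_
    · have hmod : (n + 3) % 4 = 1 ∨ (n + 3) % 4 = 2 ∨ (n + 3) % 4 = 3 := by omega
      rcases hmod with hr | hr | hr
      · exact exists_cycleGraph_isSecondColoring (m := (n + 3) / 4 - 1) (L := 5)
          (by omega) (by omega)
          ![2, 3, 0, 1, 2, 3, 0, 1, 4] ![0, 1, 2, 3, 0, 1, 4, 2, 3] (by decide)
      · exact exists_cycleGraph_isSecondColoring (m := (n + 3) / 4 - 1) (L := 6)
          (by omega) (by omega)
          ![2, 3, 0, 1, 2, 4, 2, 1, 4, 1] ![0, 1, 2, 3, 0, 1, 3, 0, 2, 3] (by decide)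
      · exact exists_cycleGraph_isSecondColoring (m := (n + 3) / 4 - 1) (L := 7)
          (by omega) (by omega)
          ![2, 3, 0, 1, 2, 3, 4, 3, 4, 0, 1] ![0, 1, 2, 3, 0, 1, 2, 0, 1, 2, 3] (by decide)
    · have hl := four_le_of_cycleGraph_isSecondColoring h
      by_contra! hlt
      obtain rfl : l = 4 := by omega
      exact h4 (four_dvd_of_cycleGraph_isSecondColoring h)
end
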